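/- For all integers s ≥ 1 and k ≥ n, the group Tor_k^R(R/I, I^s) vanishes. -/

import Mathlib

open CategoryTheory

noncomputable section

/-- The functor `Tor_k^R(R/I, -)` on `R`-modules. -/
def TorF (R : Type) [CommRing R] (I : Ideal R) (k : ℕ) :
    ModuleCat R ⥤ ModuleCat R :=
  (Tor (ModuleCat R) k).obj (ModuleCat.of R (R ⧸ I))

end

section Helpers

open CategoryTheory Limits
variable {R : Type} [CommRing R]

inductive Good : Ideal R → ℕ → Prop
  | bot : Good ⊥ 0
  | step (K : Ideal R) (n : ℕ) (y : R) (h : Good K n) (hy : ∀ a, y * a ∈ K → a ∈ K) :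
      Good (K ⊔ Ideal.span {y}) (n + 1)

theorem good_of_list (l : List R) (h : RingTheory.Sequence.IsWeaklyRegular R l) :
    Good (Ideal.ofList l) l.length := by
  induction l using List.reverseRecOn with
  | nil => simpa using Good.bot
  | append_singleton l y ih =>
    rw [RingTheory.Sequence.isWeaklyRegular_append_iff,
      RingTheory.Sequence.isWeaklyRegular_singleton_iff] at h
    rw [Ideal.ofList_append, Ideal.ofList_singleton, List.length_append, List.length_singleton]
    refine Good.step _ _ _ (ih h.1) fun a ha => ?_
    have h2 := h.2
    have key : y • (Submodule.Quotient.mk a : R ⧸ (Ideal.ofList l • ⊤ : Submodule R R)) = y • 0 := by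
      rw [smul_zero, ← Submodule.Quotient.mk_smul, Submodule.Quotient.mk_eq_zero]
      simpa using ha
    have := h2 key
    rw [Submodule.Quotient.mk_eq_zero] at this
    simpa using this

theorem sup_pow_succ (K : Ideal R) (y : R) (s : ℕ) :
    (K ⊔ Ideal.span {y}) ^ (s + 1) = K ^ (s + 1) ⊔ Ideal.span {y} * (K ⊔ Ideal.span {y}) ^ s := by
  induction s with
  | zero => simp
  | succ s ih =>
    apply le_antisymm
    · rw [pow_succ' _ (s+1), Ideal.sup_mul]
      refine sup_le ?_ le_sup_right
      conv_lhs => rw [ih]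
      rw [Ideal.mul_sup, ← pow_succ']
      refine sup_le_sup_left ?_ _
      rw [mul_left_comm, pow_succ' _ s]
      exact Ideal.mul_mono_right (Ideal.mul_mono_left le_sup_left)
    · refine sup_le (Ideal.pow_right_mono le_sup_left _) ?_
      rw [pow_succ' _ (s+1)]
      exact Ideal.mul_mono_left le_sup_right

theorem nzd_pow_of_Q (J : Ideal R)
    (Q : ∀ (s : ℕ) (L : Ideal R), J ≤ L → ∀ x, (∀ a, x * a ∈ L → a ∈ L) →
      ∀ a ∈ J ^ s, x * a ∈ L * J ^ s → a ∈ L * J ^ s)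
    (x : R) (hx : ∀ a, x * a ∈ J → a ∈ J) (s : ℕ) :
    ∀ a, x * a ∈ J ^ s → a ∈ J ^ s := by
  induction s with
  | zero => simp
  | succ s ih =>
    intro a ha
    rw [pow_succ'] at ha ⊢
    exact Q s J le_rfl x hx a (ih a ((Ideal.mul_le_right : J * J ^ s ≤ J ^ s) ha)) ha

theorem goodQ {J : Ideal R} {n : ℕ} (h : Good J n) :
    ∀ (s : ℕ) (L : Ideal R), J ≤ L → ∀ x, (∀ a, x * a ∈ L → a ∈ L) →
      ∀ a ∈ J ^ s, x * a ∈ L * J ^ s → a ∈ L * J ^ s := by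
  induction h with
  | bot =>
    intro s L hL x hx a ha hxa
    cases s with
    | zero => simpa using hx a (by simpa using hxa)
    | succ s =>
      rw [pow_succ, Ideal.mul_bot, Ideal.mem_bot] at ha
      simp [ha]
  | step K n y hK hy ih =>
    intro s
    induction s with
    | zero =>
      intro L hL x hx a ha hxa
      simpa using hx a (by simpa using hxa)
    | succ s ihs =>
      intro L hL x hx a ha hxa
      have hKL : K ≤ L := le_sup_left.trans hL
      have hyL : y ∈ L := hL (Ideal.mem_sup_right (Ideal.mem_span_singleton_self y))
      have hny := nzd_pow_of_Q K ih y hy (s+1)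
      have hKJ : K ^ (s+1) ≤ L * (K ⊔ Ideal.span {y}) ^ s := by
        rw [pow_succ']
        exact Ideal.mul_mono hKL (Ideal.pow_right_mono le_sup_left _)
      rw [sup_pow_succ] at ha hxa ⊢
      rw [Ideal.mul_sup, mul_left_comm] at hxa ⊢
      obtain ⟨u, hu, b', hb', rfl⟩ := Submodule.mem_sup.1 ha
      obtain ⟨b, hb, rfl⟩ := Ideal.mem_span_singleton_mul.1 hb'
      obtain ⟨v, hv, w', hw', hvw⟩ := Submodule.mem_sup.1 hxa
      obtain ⟨w, hw, rfl⟩ := Ideal.mem_span_singleton_mul.1 hw'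
      have hz : w - x * b ∈ K ^ (s+1) := by
        apply hny
        have : y * (w - x * b) = x * u - v := by linear_combination hvw
        rw [this]
        exact sub_mem (Ideal.mul_mem_left _ _ hu) ((Ideal.mul_le_right : L * K ^ (s+1) ≤ K ^ (s+1)) hv)
      have hu' : u ∈ L * K ^ (s+1) := by
        refine ih (s+1) L hKL x hx u hu ?_
        have : x * u = v + y * (w - x * b) := by linear_combination -hvw
        rw [this]
        exact add_mem hv (Ideal.mul_mem_mul hyL hz)
      have hb2 : b ∈ L * (K ⊔ Ideal.span {y}) ^ s := by
        refine ihs L hL x hx b hb ?_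
        have : x * b = w - (w - x * b) := by ring
        rw [this]
        exact sub_mem hw (hKJ hz)
      exact add_mem (Ideal.mem_sup_left hu')
        (Ideal.mem_sup_right (Ideal.mul_mem_mul (Ideal.mem_span_singleton_self y) hb2))

theorem pd_good {J : Ideal R} {n : ℕ} (h : Good J n) (s : ℕ) :
    HasProjectiveDimensionLT (ModuleCat.of R ↥(J ^ (s+1))) n := by
  induction h generalizing s with
  | bot =>
    apply IsZero.hasProjectiveDimensionLT_zero
    rw [ModuleCat.isZero_iff_subsingleton]
    rw [pow_succ, Ideal.mul_bot]
    exact inferInstanceAs (Subsingleton (⊥ : Ideal R))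
  | step K n y hK hy ih =>
    have hny := nzd_pow_of_Q K (goodQ hK) y hy
    suffices H : ∀ t, HasProjectiveDimensionLT (ModuleCat.of R ↥((K ⊔ Ideal.span {y}) ^ t)) (n+1) from
      H _
    intro t
    induction t with
    | zero =>
      have : Projective (ModuleCat.of R ↥((K ⊔ Ideal.span {y}) ^ 0)) := by
        have e : R ≃ₗ[R] ↥((K ⊔ Ideal.span {y}) ^ 0) :=
          (Submodule.topEquiv (R := R) (M := R)).symm.trans
            (LinearEquiv.ofEq _ _ (by simp))
        have : Module.Projective R ↥((K ⊔ Ideal.span {y}) ^ 0) := Module.Projective.of_equiv e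
        exact (IsProjective.iff_projective _).1 this
      exact hasProjectiveDimensionLT_of_ge _ 1 _ (by omega)
    | succ t iht =>
      set J := K ⊔ Ideal.span {y} with hJ
      have hsub : K ^ (t+1) ≤ J ^ t :=
        (Ideal.pow_le_pow_right (Nat.le_succ t)).trans (Ideal.pow_right_mono le_sup_left _)
      have hsub' : K ^ (t+1) ≤ J ^ (t+1) := Ideal.pow_right_mono le_sup_left _
      have hyJ : y ∈ J := Ideal.mem_sup_right (Ideal.mem_span_singleton_self y)
      let f : ↥(K ^ (t+1)) →ₗ[R] ↥(K ^ (t+1)) × ↥(J ^ t) :=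
        LinearMap.prod (-(y • LinearMap.id)) (Submodule.inclusion hsub)
      let g : ↥(K ^ (t+1)) × ↥(J ^ t) →ₗ[R] ↥(J ^ (t+1)) :=
        LinearMap.coprod (Submodule.inclusion hsub')
          (LinearMap.codRestrict _ (y • (J ^ t).subtype) fun c => by
            simpa [pow_succ'] using Ideal.mul_mem_mul hyJ c.2)
      have hfg : ∀ z, g (f z) = 0 := fun z => by
        ext; simp [f, g]
      let S : ShortComplex (ModuleCat R) := ShortComplex.mk (ModuleCat.ofHom f) (ModuleCat.ofHom g)
        (by ext z : 2; exact hfg z)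
      have hS : S.ShortExact := by
        refine ShortComplex.ShortExact.mk' ?_ ?_ ?_
        · rw [ShortComplex.moduleCat_exact_iff]
          rintro ⟨a, b⟩ hab
          have hab' : (a : R) + y * b = 0 := congrArg Subtype.val hab
          have hb : (b : R) ∈ K ^ (t+1) := by
            apply hny
            rw [← neg_eq_of_add_eq_zero_right hab']
            exact neg_mem a.2
          refine ⟨⟨b, hb⟩, ?_⟩
          refine Prod.ext (Subtype.ext ?_) (Subtype.ext rfl)
          show -(y * (b:R)) = a
          linear_combination -hab'
        · rw [ModuleCat.mono_iff_injective]
          intro a b hab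
          have : (f a).2 = (f b).2 := congrArg Prod.snd hab
          exact Subtype.ext (congrArg (fun z : ↥(J ^ t) => (z : R)) this)
        · rw [ModuleCat.epi_iff_surjective]
          rintro ⟨c, hc⟩
          have hc' := hc
          rw [hJ, sup_pow_succ] at hc'
          obtain ⟨u, hu, b', hb', rfl⟩ := Submodule.mem_sup.1 hc'
          obtain ⟨b, hb, rfl⟩ := Ideal.mem_span_singleton_mul.1 hb'
          exact ⟨(⟨u, hu⟩, ⟨b, hb⟩), Subtype.ext rfl⟩
      refine hS.hasProjectiveDimensionLT_X₃ n (ih t) ?_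
      have := ih t
      have : HasProjectiveDimensionLT (ModuleCat.of R ↥(K ^ (t+1))) (n+1) :=
        hasProjectiveDimensionLT_of_ge _ n _ (Nat.le_succ n)
      exact hasProjectiveDimensionLT_of_iso (ModuleCat.biprodIsoProd
        (ModuleCat.of R ↥(K ^ (t+1))) (ModuleCat.of R ↥(J ^ t))) _


section
universe u v
variable {C : Type u} [Category.{v} C] [Abelian C]

theorem exact_glue {A' A B Q E : C} (p : A' ⟶ A) (j : A ⟶ B) (q : B ⟶ Q) (m : Q ⟶ E)
    [Epi p] [Mono m] (w : j ≫ q = 0) (h : (ShortComplex.mk j q w).Exact)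
    {f : A' ⟶ B} {g : B ⟶ E} (w' : f ≫ g = 0)
    (hf : p ≫ j = f) (hg : q ≫ m = g) : (ShortComplex.mk f g w').Exact := by
  subst hf hg
  have w1 : (p ≫ j) ≫ q = 0 := by simp [w]
  let φ : ShortComplex.mk (p ≫ j) q w1 ⟶ ShortComplex.mk j q w :=
    { τ₁ := p, τ₂ := 𝟙 _, τ₃ := 𝟙 _ }
  let ψ : ShortComplex.mk (p ≫ j) q w1 ⟶ ShortComplex.mk (p ≫ j) (q ≫ m) w' :=
    { τ₁ := 𝟙 _, τ₂ := 𝟙 _, τ₃ := m }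
  have : Epi φ.τ₁ := by dsimp [φ]; infer_instance
  have : IsIso φ.τ₂ := by dsimp [φ]; infer_instance
  have : Mono φ.τ₃ := by dsimp [φ]; infer_instance
  have : Epi ψ.τ₁ := by dsimp [ψ]; infer_instance
  have : IsIso ψ.τ₂ := by dsimp [ψ]; infer_instance
  have : Mono ψ.τ₃ := by dsimp [ψ]; infer_instance
  exact (ShortComplex.exact_iff_of_epi_of_isIso_of_mono ψ).1
    ((ShortComplex.exact_iff_of_epi_of_isIso_of_mono φ).2 h)

theorem syz_ses {M : C} (P : ProjectiveResolution M) (i : ℕ)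
    (w : P.complex.fromOpcycles (i+1) i ≫ P.complex.pOpcycles i = 0) :
    (ShortComplex.mk (P.complex.fromOpcycles (i+1) i) (P.complex.pOpcycles i) w).ShortExact := by
  refine ShortComplex.ShortExact.mk' ?_ ?_ ?_
  · let S' : ShortComplex C := ShortComplex.mk (P.complex.d (i+1) i) (P.complex.pOpcycles i) (by simp)
    have hS' : S'.Exact := ShortComplex.exact_of_g_is_cokernel _
      (P.complex.opcyclesIsCokernel (i+1) i (by simp))
    let φ : S' ⟶ ShortComplex.mk (P.complex.fromOpcycles (i+1) i) (P.complex.pOpcycles i) w :=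
      { τ₁ := P.complex.pOpcycles (i+1)
        τ₂ := 𝟙 _
        τ₃ := 𝟙 _
        comm₁₂ := by simp [S']
        comm₂₃ := by simp [S'] }
    have : Epi φ.τ₁ := by dsimp [φ]; infer_instance
    have : IsIso φ.τ₂ := by dsimp [φ]; infer_instance
    have : Mono φ.τ₃ := by dsimp [φ]; infer_instance
    exact (ShortComplex.exact_iff_of_epi_of_isIso_of_mono φ).1 hS'
  · have h := P.complex_exactAt_succ i
    rw [HomologicalComplex.exactAt_iff_isZero_homology] at h
    exact Preadditive.mono_of_isZero_kernel' _
      (P.complex.homologyIsKernel (i+1) i (by simp)) h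
  · dsimp only; infer_instance

theorem syz_w {M : C} (P : ProjectiveResolution M) (i : ℕ) :
    P.complex.fromOpcycles (i+1) i ≫ P.complex.pOpcycles i = 0 := by
  rw [← cancel_epi (P.complex.pOpcycles (i+1))]; simp

theorem syz_pd {M : C} (P : ProjectiveResolution M) (n : ℕ) [HasProjectiveDimensionLT M (n+1)]
    (i : ℕ) (m : ℕ) (hm : n ≤ m + i) :
    HasProjectiveDimensionLT (P.complex.opcycles i) (m+1) := by
  induction i generalizing m with
  | zero =>
    have : HasProjectiveDimensionLT M (m+1) := hasProjectiveDimensionLT_of_ge _ (n+1) _ (by omega)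
    have e : P.complex.opcycles 0 ≅ M :=
      (P.complex.opcyclesIsCokernel 1 0 (by simp)).coconePointUniqueUpToIso P.isColimitCokernelCofork
    exact hasProjectiveDimensionLT_of_iso e.symm _
  | succ i ih =>
    refine (syz_ses P i (syz_w P i)).hasProjectiveDimensionLT_X₁ (m+1) ?_ ?_
    · have : Projective (P.complex.X i) := inferInstance
      exact hasProjectiveDimensionLT_of_ge _ 1 _ (by omega)
    · exact ih (m+1) (by omega)

theorem isZero_leftDerived_of_pd {D : Type*} [Category* D] [Abelian D] [HasProjectiveResolutions C]
    (F : C ⥤ D) [F.Additive]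
    [PreservesFiniteColimits F] (M : C) (n : ℕ) [HasProjectiveDimensionLT M n] (k : ℕ)
    (hk : n ≤ k) : IsZero ((F.leftDerived k).obj M) := by
  cases k with
  | zero =>
    obtain rfl : n = 0 := by omega
    have := isZero_of_hasProjectiveDimensionLT_zero M
    exact (F.map_isZero this).of_iso (F.leftDerivedZeroIsoSelf.app M)
  | succ k =>
    have : HasProjectiveDimensionLT M (k+1) := hasProjectiveDimensionLT_of_ge _ n _ hk
    let P := projectiveResolution M
    refine IsZero.of_iso ?_ (P.isoLeftDerivedObj F (k+1))
    have hp : HasProjectiveDimensionLT (P.complex.opcycles k) 1 := syz_pd P k k 0 (by omega)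
    have hproj : Projective (P.complex.opcycles k) :=
      projective_iff_hasProjectiveDimensionLT_one.mpr hp
    have h1 := syz_ses P k (syz_w P k)
    have h2 := syz_ses P (k+1) (syz_w P (k+1))
    have hm : Mono (F.map (P.complex.fromOpcycles (k+1) k)) := by
      have : Projective (ShortComplex.mk _ _ (syz_w P k)).X₃ := hproj
      have sp := h1.splittingOfProjective
      have : IsSplitMono (P.complex.fromOpcycles (k+1) k) := ⟨⟨sp.splitMono_f⟩⟩
      infer_instance
    have hE := ShortComplex.Exact.map_of_epi_of_preservesCokernel h2.exact F h2.epi_g inferInstance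
    erw [← HomologicalComplex.exactAt_iff_isZero_homology]
    rw [HomologicalComplex.exactAt_iff' _ (k+2) (k+1) k (by simp) (by simp)]
    have := h2.epi_g
    have e1 : Epi (F.map (P.complex.pOpcycles (k+2))) := F.map_epi _
    refine exact_glue (F.map (P.complex.pOpcycles (k+2)))
      (F.map (P.complex.fromOpcycles (k+2) (k+1))) (F.map (P.complex.pOpcycles (k+1)))
      (F.map (P.complex.fromOpcycles (k+1) k)) _ hE _ ?_ ?_
    · rw [← F.map_comp, HomologicalComplex.p_fromOpcycles]; rfl
    · rw [← F.map_comp, HomologicalComplex.p_fromOpcycles]; rfl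
end

theorem tor_zero (R : Type) [CommRing R] (X M : ModuleCat.{0} R) (n k : ℕ) [HasProjectiveDimensionLT M n]
    (hk : n ≤ k) : IsZero (((Tor (ModuleCat R) k).obj X).obj M) := 
  have : PreservesFiniteColimits ((MonoidalCategory.tensoringLeft (ModuleCat.{0} R)).obj X) := by
    have : PreservesColimits (MonoidalCategory.tensorLeft X) := inferInstance
    exact inferInstanceAs (PreservesFiniteColimits (MonoidalCategory.tensorLeft X))
  isZero_leftDerived_of_pd _ _ n _ hk

end Helpers

/-- Let `r : Fin n → R` be a regular sequence generating the ideal `I`.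
For all `s ≥ 1` and `k ≥ n`, the group `Tor_k^R(R/I, I^s)` vanishes. -/
theorem stmt_15 (R : Type) [CommRing R] {n : ℕ} (r : Fin n → R)
    (hreg : RingTheory.Sequence.IsRegular R (List.ofFn r))
    (I : Ideal R) (hI : I = Ideal.span (Set.range r)) (s : ℕ) (hs : 1 ≤ s)
    (k : ℕ) (hk : n ≤ k) :
    Subsingleton ((TorF R I k).obj (ModuleCat.of R ↥(I ^ s))) := by
  subst hI
  obtain ⟨s, rfl⟩ : ∃ t, s = t + 1 := ⟨s - 1, by omega⟩
  have h := good_of_list _ hreg.toIsWeaklyRegular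
  have e : Ideal.ofList (List.ofFn r) = Ideal.span (Set.range r) := by
    unfold Ideal.ofList
    congr 1
    ext x
    simp [List.mem_ofFn]
  rw [List.length_ofFn, e] at h
  have := pd_good h s
  rw [← ModuleCat.isZero_iff_subsingleton]
  exact tor_zero R _ _ n k hk
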